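/- arXiv:1901.00373 — 6 statements merged into one kernel-verified Lean document; each statement's English description precedes it below -/
import Mathlib

section
/- For every network state S and every agent i, the incremental utility of agent i from switching her action equals the incremental potential: Δ_{a_i} u_i(S) = Δ_{a_i} Φ(S); explicitly, both are equal to v_i + h·Σ_{j ≠ i} a_j + φ·Σ_{j ≠ i} g_{ij}(2a_j − 1). -/
open Finset

namespace NEkSN

/-- A network state: a profile of binary actions together with a symmetric,
loopless adjacency matrix of friendship links. -/
abbrev NetState (n : ℕ) :=
  {S : (Fin n → Bool) × (Fin n → Fin n → Bool) //
    (∀ i j, S.2 i j = S.2 j i) ∧ ∀ i, S.2 i i = false}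

variable {n : ℕ}

noncomputable section

/-- The (real-valued) action of agent `i`. -/
def act (S : NetState n) (i : Fin n) : ℝ := if S.1.1 i then 1 else 0

/-- The (real-valued) link indicator between `i` and `j`. -/
def lnk (S : NetState n) (i j : Fin n) : ℝ := if S.1.2 i j then 1 else 0

/-- Agent `i`'s utility. -/
def util (v : Fin n → ℝ) (w : Fin n → Fin n → ℝ) (q : Fin n → Fin n → Fin n → ℝ)
    (h φ : ℝ) (i : Fin n) (S : NetState n) : ℝ :=
  act S i * v i
    + ∑ j ∈ univ.erase i, lnk S i j * w i j
    + ∑ j ∈ univ.erase i, ∑ k ∈ univ.erase i,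
        (if j < k then q i j k * lnk S i j * lnk S j k * lnk S k i else 0)
    + h * act S i * ∑ j ∈ univ.erase i, act S j
    + φ * ∑ j ∈ univ.erase i,
        lnk S i j * (act S i * act S j + (1 - act S i) * (1 - act S j))

/-- The potential function. -/
def potential (v : Fin n → ℝ) (w : Fin n → Fin n → ℝ) (q : Fin n → Fin n → Fin n → ℝ)
    (h φ : ℝ) (S : NetState n) : ℝ :=
  (∑ i, act S i * v i)
    + (1 / 2) * ∑ i, ∑ j ∈ univ.erase i, lnk S i j * w i j
    + (h / 2) * ∑ i, ∑ j ∈ univ.erase i, act S i * act S j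
    + (φ / 2) * ∑ i, ∑ j ∈ univ.erase i,
        lnk S i j * (act S i * act S j + (1 - act S i) * (1 - act S j))
    + ∑ i, ∑ j, ∑ k, (if i < j ∧ j < k then q i j k * lnk S i j * lnk S j k * lnk S k i else 0)

/-- The state `S` with `i`'s action set to `b`. -/
def setAct (S : NetState n) (i : Fin n) (b : Bool) : NetState n :=
  ⟨(Function.update S.1.1 i b, S.1.2), S.2⟩

/-- The state `S` with the link between `i` and `j` (`i ≠ j`) set to `b`. -/
def setLink (S : NetState n) (i j : Fin n) (b : Bool) : NetState n :=
  ⟨(S.1.1, fun p q =>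
      if p = q then false
      else if (p = i ∧ q = j) ∨ (p = j ∧ q = i) then b else S.1.2 p q), by
    refine ⟨fun p q => ?_, fun p => ?_⟩
    · by_cases hpq : p = q
      · simp [hpq]
      · have hqp : ¬q = p := fun hc => hpq hc.symm
        simp only [if_neg hpq, if_neg hqp]
        by_cases hc : (p = i ∧ q = j) ∨ (p = j ∧ q = i)
        · rw [if_pos hc, if_pos (by tauto)]
        · rw [if_neg hc, if_neg (by tauto), S.2.1 p q]
    · simp⟩

/-- The state `S` with all links between `i` and members of `D` deleted. -/
def deleteLinks (S : NetState n) (i : Fin n) (D : Finset (Fin n)) : NetState n :=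
  ⟨(S.1.1, fun p q => if (p = i ∧ q ∈ D) ∨ (q = i ∧ p ∈ D) then false else S.1.2 p q), by
    refine ⟨fun p q => ?_, fun p => ?_⟩
    · dsimp only
      by_cases hc : (p = i ∧ q ∈ D) ∨ (q = i ∧ p ∈ D)
      · rw [if_pos hc, if_pos (by tauto)]
      · rw [if_neg hc, if_neg (by tauto), S.2.1 p q]
    · dsimp only
      split
      · rfl
      · exact S.2.2 p⟩

/-- Incremental utility of agent `i` from switching her action on. -/
def dActU (v : Fin n → ℝ) (w : Fin n → Fin n → ℝ) (q : Fin n → Fin n → Fin n → ℝ)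
    (h φ : ℝ) (i : Fin n) (S : NetState n) : ℝ :=
  util v w q h φ i (setAct S i true) - util v w q h φ i (setAct S i false)

/-- Incremental potential from switching `i`'s action on. -/
def dActP (v : Fin n → ℝ) (w : Fin n → Fin n → ℝ) (q : Fin n → Fin n → Fin n → ℝ)
    (h φ : ℝ) (i : Fin n) (S : NetState n) : ℝ :=
  potential v w q h φ (setAct S i true) - potential v w q h φ (setAct S i false)

/-- Incremental utility of agent `i` from the link with `j`. -/
def dLinkU (v : Fin n → ℝ) (w : Fin n → Fin n → ℝ) (q : Fin n → Fin n → Fin n → ℝ)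
    (h φ : ℝ) (i j : Fin n) (S : NetState n) : ℝ :=
  util v w q h φ i (setLink S i j true) - util v w q h φ i (setLink S i j false)

/-- Incremental potential from the link between `i` and `j`. -/
def dLinkP (v : Fin n → ℝ) (w : Fin n → Fin n → ℝ) (q : Fin n → Fin n → Fin n → ℝ)
    (h φ : ℝ) (i j : Fin n) (S : NetState n) : ℝ :=
  potential v w q h φ (setLink S i j true) - potential v w q h φ (setLink S i j false)

/-- A `k`-meeting: an agent `i` together with a set of `k - 1` other agents. -/
abbrev Meeting (n k : ℕ) :=
  {μ : Fin n × Finset (Fin n) // μ.1 ∉ μ.2 ∧ μ.2.card = k - 1}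

/-- The `k`-neighborhood of `S` for meeting `μ = (i, I)`: all states agreeing with `S`
except possibly in `i`'s action and the links between `i` and members of `I`. -/
def nbhd {k : ℕ} (μ : Meeting n k) (S : NetState n) : Finset (NetState n) :=
  univ.filter fun S' =>
    (∀ p, p ≠ μ.1.1 → S'.1.1 p = S.1.1 p) ∧
    (∀ p q, ¬((p = μ.1.1 ∧ q ∈ μ.1.2) ∨ (q = μ.1.1 ∧ p ∈ μ.1.2)) → S'.1.2 p q = S.1.2 p q)

/-- The feasible set for the decision problem of `μ.1` on the neighborhood of `S`:
states in the neighborhood satisfying the stability constraints. -/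
def feasible (v : Fin n → ℝ) (w : Fin n → Fin n → ℝ) (q : Fin n → Fin n → Fin n → ℝ)
    (h φ : ℝ) {k : ℕ} (μ : Meeting n k) (S : NetState n) : Set (NetState n) :=
  {S' | S' ∈ nbhd μ S ∧
    ∀ j ∈ μ.1.2, S'.1.2 μ.1.1 j = true → 0 ≤ dLinkU v w q h φ j μ.1.1 S'}

/-- Nash equilibrium in a `k`(-player) stable network. -/
def isNEkSN (v : Fin n → ℝ) (w : Fin n → Fin n → ℝ) (q : Fin n → Fin n → Fin n → ℝ)
    (h φ : ℝ) (k : ℕ) (S : NetState n) : Prop :=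
  ∀ μ : Meeting n k,
    S ∈ feasible v w q h φ μ S ∧
    ∀ T ∈ feasible v w q h φ μ S, util v w q h φ μ.1.1 T ≤ util v w q h φ μ.1.1 S

/-- One-step transition kernel of the `k`-player consensual dynamic with logit shocks:
`kernel … ρ S' S = P_k(S' | S)`. -/
def kernel (v : Fin n → ℝ) (w : Fin n → Fin n → ℝ) (q : Fin n → Fin n → Fin n → ℝ)
    (h φ : ℝ) (k : ℕ) (ρ : Meeting n k → ℝ) (S' S : NetState n) : ℝ :=
  ∑ μ : Meeting n k,
    if S' ∈ nbhd μ S then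
      ρ μ * Real.exp (potential v w q h φ S') /
        ∑ T ∈ nbhd μ S, Real.exp (potential v w q h φ T)
    else 0

/-- The Gibbs (stationary) distribution `π(S) ∝ exp (Φ S)`. -/
def gibbs (v : Fin n → ℝ) (w : Fin n → Fin n → ℝ) (q : Fin n → Fin n → Fin n → ℝ)
    (h φ : ℝ) (S : NetState n) : ℝ :=
  Real.exp (potential v w q h φ S) / ∑ T : NetState n, Real.exp (potential v w q h φ T)

/-- `m`-step transition probabilities of the `k`CD. -/
def kernelIter (v : Fin n → ℝ) (w : Fin n → Fin n → ℝ) (q : Fin n → Fin n → Fin n → ℝ)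
    (h φ : ℝ) (k : ℕ) (ρ : Meeting n k → ℝ) : ℕ → NetState n → NetState n → ℝ
  | 0, S', S => if S' = S then 1 else 0
  | m + 1, S', S =>
      ∑ T : NetState n, kernel v w q h φ k ρ S' T * kernelIter v w q h φ k ρ m T S

/-- The eigenfunction `e_I` associated with a set `I` of coordinate pairs `(i, j)`, `i ≥ j`:
`(i, i)` refers to the action `a_i` and `(i, j)` with `i > j` to the link `g_{ij}`. -/
def eig (I : Finset (Fin n × Fin n)) (S : NetState n) : ℝ :=
  ∏ p ∈ I,
    if p.1 = p.2 then (if S.1.1 p.1 then (-1 : ℝ) else 1)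
    else (if S.1.2 p.1 p.2 then (-1 : ℝ) else 1)

/-- `I_i = {j ≠ i : (i, j) ∈ I or (j, i) ∈ I}`. -/
def linkedSet (I : Finset (Fin n × Fin n)) (i : Fin n) : Finset (Fin n) :=
  univ.filter fun j => j ≠ i ∧ ((i, j) ∈ I ∨ (j, i) ∈ I)

/-- The eigenvalue `λ_{k,I}`. -/
def lam (k : ℕ) (I : Finset (Fin n × Fin n)) : ℝ :=
  (∑ i ∈ univ.filter (fun i : Fin n => (i, i) ∉ I),
      ((n - 1 - (linkedSet I i).card).choose (k - 1) : ℝ))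
    / (n * ((n - 1).choose (k - 1) : ℝ))

/-- The one-flip neighborhood `N(S)`: states obtained from `S` by flipping exactly one
coordinate (one action or one link). -/
def flipNbhd (S : NetState n) : Set (NetState n) :=
  {S' | (∃ i, S' = setAct S i (!S.1.1 i)) ∨
        ∃ i j, i ≠ j ∧ S' = setLink S i j (!S.1.2 i j)}

end



theorem pair_sum_aux {n : ℕ} (i : Fin n) (F G : Fin n → Fin n → ℝ)
    (hF : ∀ p j, F p j = F j p) (hG : ∀ p j, G p j = G j p)
    (hFG : ∀ p j, p ≠ i → j ≠ i → F p j = G p j) :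
    (∑ p, ∑ j ∈ univ.erase p, F p j) - (∑ p, ∑ j ∈ univ.erase p, G p j)
      = 2 * ∑ j ∈ univ.erase i, (F i j - G i j) := by
  rw [← Finset.sum_sub_distrib, ← Finset.add_sum_erase univ _ (Finset.mem_univ i), two_mul]
  congr 1
  · rw [Finset.sum_sub_distrib]
  · refine Finset.sum_congr rfl fun p hp => ?_
    have hpi : p ≠ i := Finset.ne_of_mem_erase hp
    rw [← Finset.sum_sub_distrib, Finset.sum_eq_single i]
    · rw [hF, hG]
    · intro j _ hj
      rw [hFG p j hpi hj, sub_self]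
    · intro hc
      exact absurd (Finset.mem_erase.2 ⟨hpi.symm, Finset.mem_univ _⟩) hc

theorem lnk_setAct_aux {n : ℕ} (S : NetState n) (i : Fin n) (b : Bool) (p j : Fin n) :
    lnk (setAct S i b) p j = lnk S p j := rfl

theorem lnk_symm_aux {n : ℕ} (S : NetState n) (p j : Fin n) :
    lnk S p j = lnk S j p := by
  unfold lnk
  rw [S.2.1 p j]

theorem act_true_aux {n : ℕ} (S : NetState n) (i : Fin n) :
    act (setAct S i true) i = 1 := by
  simp [act, setAct]

theorem act_false_aux {n : ℕ} (S : NetState n) (i : Fin n) :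
    act (setAct S i false) i = 0 := by
  simp [act, setAct]

theorem act_ne_aux {n : ℕ} (S : NetState n) (i : Fin n) (b : Bool) (p : Fin n) (hp : p ≠ i) :
    act (setAct S i b) p = act S p := by
  simp [act, setAct, Function.update_of_ne hp]

/-- the incremental utility from switching the action equals the incremental
potential, and both equal `v_i + h Σ_{j≠i} a_j + φ Σ_{j≠i} g_{ij} (2 a_j − 1)`. -/
theorem action_increment_eq_potential_increment {n : ℕ} (hn : 2 ≤ n)
    (v : Fin n → ℝ) (w : Fin n → Fin n → ℝ) (hw : ∀ i j, w i j = w j i)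
    (q : Fin n → Fin n → Fin n → ℝ)
    (hq1 : ∀ i j k, q i j k = q j i k) (hq2 : ∀ i j k, q i j k = q i k j)
    (h φ : ℝ) (S : NetState n) (i : Fin n) :
    dActU v w q h φ i S = dActP v w q h φ i S ∧
    dActU v w q h φ i S =
      v i + h * (∑ j ∈ Finset.univ.erase i, act S j)
        + φ * ∑ j ∈ Finset.univ.erase i, lnk S i j * (2 * act S j - 1) := by
  have hsum : ∀ b, ∑ j ∈ Finset.univ.erase i, act (setAct S i b) j
      = ∑ j ∈ Finset.univ.erase i, act S j := fun b =>
    Finset.sum_congr rfl fun j hj => act_ne_aux S i b j (Finset.ne_of_mem_erase hj)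
  have hU : dActU v w q h φ i S =
      v i + h * (∑ j ∈ Finset.univ.erase i, act S j)
        + φ * ∑ j ∈ Finset.univ.erase i, lnk S i j * (2 * act S j - 1) := by
    have e : ∑ j ∈ Finset.univ.erase i, lnk S i j * (2 * act S j - 1)
        = (∑ j ∈ univ.erase i, lnk S i j * (1 * act (setAct S i true) j
            + (1 - 1) * (1 - act (setAct S i true) j)))
          - ∑ j ∈ univ.erase i, lnk S i j * (0 * act (setAct S i false) j
            + (1 - 0) * (1 - act (setAct S i false) j)) := by
      rw [← Finset.sum_sub_distrib]
      refine Finset.sum_congr rfl fun j hj => ?_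
      rw [act_ne_aux S i _ j (Finset.ne_of_mem_erase hj),
        act_ne_aux S i _ j (Finset.ne_of_mem_erase hj)]
      ring
    rw [e]
    unfold dActU util
    simp only [lnk_setAct_aux, act_true_aux, act_false_aux, hsum]
    ring
  refine ⟨?_, hU⟩
  rw [hU]
  have h1 : (∑ p, act (setAct S i true) p * v p) - (∑ p, act (setAct S i false) p * v p)
      = v i := by
    rw [← Finset.sum_sub_distrib, Finset.sum_eq_single i]
    · rw [act_true_aux, act_false_aux]; ring
    · intro p _ hp
      rw [act_ne_aux S i _ p hp, act_ne_aux S i _ p hp, sub_self]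
    · intro hc
      exact absurd (Finset.mem_univ i) hc
  have h2 := pair_sum_aux i
    (fun p j => act (setAct S i true) p * act (setAct S i true) j)
    (fun p j => act (setAct S i false) p * act (setAct S i false) j)
    (fun p j => mul_comm _ _) (fun p j => mul_comm _ _)
    (fun p j hp hj => by
      simp only [act_ne_aux S i _ p hp, act_ne_aux S i _ j hj])
  have h3 := pair_sum_aux i
    (fun p j => lnk S p j * (act (setAct S i true) p * act (setAct S i true) j
      + (1 - act (setAct S i true) p) * (1 - act (setAct S i true) j)))
    (fun p j => lnk S p j * (act (setAct S i false) p * act (setAct S i false) j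
      + (1 - act (setAct S i false) p) * (1 - act (setAct S i false) j)))
    (fun p j => by simp only [lnk_symm_aux S p j]; ring)
    (fun p j => by simp only [lnk_symm_aux S p j]; ring)
    (fun p j hp hj => by
      simp only [act_ne_aux S i _ p hp, act_ne_aux S i _ j hj])
  have e2 : ∑ j ∈ univ.erase i, (act (setAct S i true) i * act (setAct S i true) j
      - act (setAct S i false) i * act (setAct S i false) j)
      = ∑ j ∈ univ.erase i, act S j := by
    refine Finset.sum_congr rfl fun j hj => ?_
    simp only [act_ne_aux S i _ j (Finset.ne_of_mem_erase hj), act_true_aux, act_false_aux]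
    ring
  have e3 : ∑ j ∈ univ.erase i,
      (lnk S i j * (act (setAct S i true) i * act (setAct S i true) j
      + (1 - act (setAct S i true) i) * (1 - act (setAct S i true) j))
      - lnk S i j * (act (setAct S i false) i * act (setAct S i false) j
      + (1 - act (setAct S i false) i) * (1 - act (setAct S i false) j)))
      = ∑ j ∈ univ.erase i, lnk S i j * (2 * act S j - 1) := by
    refine Finset.sum_congr rfl fun j hj => ?_
    simp only [act_ne_aux S i _ j (Finset.ne_of_mem_erase hj), act_true_aux, act_false_aux]
    ring
  rw [e2] at h2
  rw [e3] at h3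
  unfold dActP potential
  simp only [lnk_setAct_aux]
  linear_combination (-1) * h1 - (h / 2) * h2 - (φ / 2) * h3

end NEkSN
end

section
/- For every network state S and all agents i ≠ j, the incremental utility of agent i from the link with j equals the incremental potential: Δ_{g_{ij}} u_i(S) = Δ_{g_{ij}} Φ(S); explicitly, both are equal to w_{ij} + φ(a_i a_j + (1 − a_i)(1 − a_j)) + Σ_{k ≠ i, k ≠ j} q_{ijk} g_{ik} g_{jk}. -/
open Finset

namespace NEkSN

variable {n : ℕ}

lemma act_setLink (S : NetState n) (i j : Fin n) (b : Bool) (p : Fin n) :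
    act (setLink S i j b) p = act S p := rfl

lemma lnk_symm (S : NetState n) (p r : Fin n) : lnk S p r = lnk S r p := by
  unfold lnk; rw [S.2.1 p r]

lemma lnk_set_self (S : NetState n) (i j : Fin n) (hij : i ≠ j) (b : Bool) :
    lnk (setLink S i j b) i j = if b then 1 else 0 := by
  simp [lnk, setLink, hij]

lemma lnk_set_self' (S : NetState n) (i j : Fin n) (hij : i ≠ j) (b : Bool) :
    lnk (setLink S i j b) j i = if b then 1 else 0 := by
  rw [lnk_symm, lnk_set_self S i j hij]

lemma lnk_set_other (S : NetState n) (i j : Fin n) (b : Bool) (p r : Fin n)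
    (hc : ¬ ((p = i ∧ r = j) ∨ (p = j ∧ r = i))) :
    lnk (setLink S i j b) p r = lnk S p r := by
  by_cases hp : p = r
  · subst hp; simp [lnk, setLink, S.2.2 p]
  · simp [lnk, setLink, hp, hc]

lemma lnk_set (S : NetState n) (i j : Fin n) (hij : i ≠ j) (b : Bool) (p r : Fin n) :
    lnk (setLink S i j b) p r =
      if (p = i ∧ r = j) ∨ (p = j ∧ r = i) then (if b then 1 else 0) else lnk S p r := by
  split_ifs with hc hb hb
  · rcases hc with ⟨rfl, rfl⟩ | ⟨rfl, rfl⟩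
    · simp [lnk_set_self S _ _ hij, hb]
    · simp [lnk_set_self' S _ _ hij, hb]
  · rcases hc with ⟨rfl, rfl⟩ | ⟨rfl, rfl⟩
    · simp [lnk_set_self S _ _ hij, hb]
    · simp [lnk_set_self' S _ _ hij, hb]
  · exact lnk_set_other S i j b p r hc

/-- Difference of a linear link sum seen from one agent. -/
lemma lin_one (S : NetState n) (i j : Fin n) (hij : i ≠ j) (f : Fin n → ℝ) :
    ∑ k ∈ univ.erase i, lnk (setLink S i j true) i k * f k
      - ∑ k ∈ univ.erase i, lnk (setLink S i j false) i k * f k = f j := by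
  rw [← Finset.sum_sub_distrib, Finset.sum_eq_single j]
  · simp [lnk_set_self S i j hij]
  · intro b _ hb
    rw [lnk_set_other, lnk_set_other, sub_self] <;> tauto
  · intro hc; simp [hij.symm] at hc

lemma setLink_comm (S : NetState n) (i j : Fin n) (b : Bool) :
    setLink S i j b = setLink S j i b := by
  apply Subtype.ext
  apply Prod.ext
  · rfl
  · funext p r
    simp only [setLink]
    congr 1
    by_cases h1 : (p = i ∧ r = j) ∨ (p = j ∧ r = i)
    · rw [if_pos h1, if_pos h1.symm]
    · rw [if_neg h1, if_neg (fun h2 => h1 h2.symm)]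

lemma lin_all (S : NetState n) (i j : Fin n) (hij : i ≠ j) (f : Fin n → Fin n → ℝ) :
    ∑ p, ∑ k ∈ univ.erase p, lnk (setLink S i j true) p k * f p k
      - ∑ p, ∑ k ∈ univ.erase p, lnk (setLink S i j false) p k * f p k = f i j + f j i := by
  rw [← Finset.sum_sub_distrib, ← Finset.sum_subset (Finset.subset_univ {i, j}),
    Finset.sum_pair hij, lin_one S i j hij, setLink_comm S i j, setLink_comm S i j,
    lin_one S j i hij.symm]
  intro p _ hp
  simp only [Finset.mem_insert, Finset.mem_singleton, not_or] at hp
  rw [← Finset.sum_sub_distrib]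
  apply Finset.sum_eq_zero
  intro k _
  rw [lnk_set_other, lnk_set_other, sub_self] <;> tauto

lemma tri_one (q : Fin n → Fin n → Fin n → ℝ)
    (hq2 : ∀ i j k, q i j k = q i k j) (S : NetState n) (i j : Fin n) (hij : i ≠ j) :
    (∑ a ∈ univ.erase i, ∑ b ∈ univ.erase i,
        (if a < b then q i a b * lnk (setLink S i j true) i a * lnk (setLink S i j true) a b
          * lnk (setLink S i j true) b i else 0))
      - ∑ a ∈ univ.erase i, ∑ b ∈ univ.erase i,
        (if a < b then q i a b * lnk (setLink S i j false) i a * lnk (setLink S i j false) a b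
          * lnk (setLink S i j false) b i else 0)
      = ∑ k ∈ (Finset.univ.erase i).erase j, q i j k * lnk S i k * lnk S j k := by
  have hj : j ∈ univ.erase i := by simp [hij.symm]
  set G : Fin n → ℝ := fun k => q i j k * lnk S i k * lnk S j k with hG
  have key : ∀ a ∈ univ.erase i, ∀ b ∈ univ.erase i,
      (if a < b then q i a b * lnk (setLink S i j true) i a * lnk (setLink S i j true) a b
          * lnk (setLink S i j true) b i else 0)
      - (if a < b then q i a b * lnk (setLink S i j false) i a * lnk (setLink S i j false) a b
          * lnk (setLink S i j false) b i else 0)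
      = (if a = j then (if j < b then G b else 0) else 0)
        + (if b = j then (if a < j then G a else 0) else 0) := by
    intro a ha b hb
    have ha' : a ≠ i := by simpa using ha
    have hb' : b ≠ i := by simpa using hb
    by_cases hab : a < b
    · have hne := hab.ne
      by_cases haj : a = j
      · subst haj
        simp [lnk_set S i a hij, hab, hne.symm, ha', hb', hG, lnk_symm S b i]
        ring
      · by_cases hbj : b = j
        · subst hbj
          simp [lnk_set S i b hij, hab, hne, ha', hb', hG, lnk_symm S a b, hq2 i a b]
        · simp [lnk_set S i j hij, hab, haj, hbj, ha', hb']
    · simp only [if_neg hab, sub_self]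
      by_cases haj : a = j
      · subst haj; simp [hab]
      · by_cases hbj : b = j
        · subst hbj; simp [hab]
        · simp [haj, hbj]
  rw [← Finset.sum_sub_distrib]
  simp_rw [← Finset.sum_sub_distrib]
  rw [Finset.sum_congr rfl (fun a ha => Finset.sum_congr rfl (fun b hb => key a ha b hb))]
  simp_rw [Finset.sum_add_distrib]
  rw [Finset.sum_comm]
  simp_rw [Finset.sum_ite_eq' (univ.erase i) j, if_pos hj]
  rw [← Finset.sum_add_distrib, ← Finset.add_sum_erase _ _ hj]
  simp only [lt_irrefl, if_false, add_zero, zero_add]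
  apply Finset.sum_congr rfl
  intro k hk
  have hk' : k ≠ j := (Finset.mem_erase.mp hk).1
  rcases lt_or_gt_of_ne hk' with h1 | h1 <;> simp [h1, h1.not_gt]

lemma sum3_ab (x y : Fin n) (H : Fin n → Fin n → Fin n → ℝ) :
    ∑ a, ∑ b, ∑ c, (if a = x ∧ b = y then H a b c else 0) = ∑ c, H x y c := by
  rw [Fintype.sum_eq_single x, Fintype.sum_eq_single y]
  · simp
  · intro b hb; simp [hb]
  · intro a ha; simp [ha]

lemma sum3_ac (x y : Fin n) (H : Fin n → Fin n → Fin n → ℝ) :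
    ∑ a, ∑ b, ∑ c, (if a = x ∧ c = y then H a b c else 0) = ∑ b, H x b y := by
  rw [Fintype.sum_eq_single x]
  · simp
  · intro a ha; simp [ha]

lemma sum3_bc (x y : Fin n) (H : Fin n → Fin n → Fin n → ℝ) :
    ∑ a, ∑ b, ∑ c, (if b = x ∧ c = y then H a b c else 0) = ∑ a, H a x y := by
  apply Finset.sum_congr rfl
  intro a _
  rw [Fintype.sum_eq_single x]
  · simp
  · intro a ha; simp [ha]

lemma tri_all (q : Fin n → Fin n → Fin n → ℝ)
    (hq1 : ∀ i j k, q i j k = q j i k) (hq2 : ∀ i j k, q i j k = q i k j)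
    (S : NetState n) (i j : Fin n) (hij : i < j) :
    (∑ a, ∑ b, ∑ c,
        (if a < b ∧ b < c then q a b c * lnk (setLink S i j true) a b
          * lnk (setLink S i j true) b c * lnk (setLink S i j true) c a else 0))
      - ∑ a, ∑ b, ∑ c,
        (if a < b ∧ b < c then q a b c * lnk (setLink S i j false) a b
          * lnk (setLink S i j false) b c * lnk (setLink S i j false) c a else 0)
      = ∑ k ∈ (Finset.univ.erase i).erase j, q i j k * lnk S i k * lnk S j k := by
  set G : Fin n → ℝ := fun k => q i j k * lnk S i k * lnk S j k with hG
  have key : ∀ a b c : Fin n,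
      (if a < b ∧ b < c then q a b c * lnk (setLink S i j true) a b
          * lnk (setLink S i j true) b c * lnk (setLink S i j true) c a else 0)
      - (if a < b ∧ b < c then q a b c * lnk (setLink S i j false) a b
          * lnk (setLink S i j false) b c * lnk (setLink S i j false) c a else 0)
      = (if a = i ∧ b = j then (if a < b ∧ b < c then G c else 0) else 0)
        + (if a = i ∧ c = j then (if a < b ∧ b < c then G b else 0) else 0)
        + (if b = i ∧ c = j then (if a < b ∧ b < c then G a else 0) else 0) := by
    intro a b c
    by_cases habc : a < b ∧ b < c
    · simp only [if_pos habc]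
      obtain ⟨hab, hbc⟩ := habc
      have hac := hab.trans hbc
      by_cases h1 : a = i ∧ b = j
      · obtain ⟨rfl, rfl⟩ := h1
        simp [lnk_set S a b hij.ne, hab.ne, hab.ne', hbc.ne, hbc.ne', hac.ne, hac.ne', hG,
          lnk_symm S c a]
        ring
      by_cases h2 : a = i ∧ c = j
      · obtain ⟨rfl, rfl⟩ := h2
        simp [lnk_set S a c hij.ne, hab.ne, hab.ne', hbc.ne, hbc.ne', hac.ne, hac.ne', hG,
          lnk_symm S b c, hq2 a b c]
      by_cases h3 : b = i ∧ c = j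
      · obtain ⟨rfl, rfl⟩ := h3
        simp [lnk_set S b c hij.ne, hab.ne, hab.ne', hbc.ne, hbc.ne', hac.ne, hac.ne', hG,
          lnk_symm S a b, hq1 a b c, hq2 b a c]
      simp only [if_neg h1, if_neg h2, if_neg h3]
      have h4 : ¬ (a = j ∧ b = i) := by rintro ⟨rfl, rfl⟩; exact lt_asymm hab hij
      have h5 : ¬ (a = j ∧ c = i) := by rintro ⟨rfl, rfl⟩; exact lt_asymm hac hij
      have h6 : ¬ (b = j ∧ c = i) := by rintro ⟨rfl, rfl⟩; exact lt_asymm hbc hij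
      have e1 : ∀ t, lnk (setLink S i j t) a b = lnk S a b :=
        fun t => lnk_set_other S i j t a b (by tauto)
      have e2 : ∀ t, lnk (setLink S i j t) b c = lnk S b c :=
        fun t => lnk_set_other S i j t b c (by tauto)
      have e3 : ∀ t, lnk (setLink S i j t) c a = lnk S c a :=
        fun t => lnk_set_other S i j t c a (by tauto)
      simp [e1, e2, e3]
    · simp [if_neg habc]
  rw [← Finset.sum_sub_distrib]
  simp_rw [← Finset.sum_sub_distrib]
  simp_rw [key, Finset.sum_add_distrib]
  rw [sum3_ab, sum3_ac, sum3_bc, ← Finset.sum_add_distrib, ← Finset.sum_add_distrib]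
  symm
  rw [← Finset.sum_subset (Finset.subset_univ ((Finset.univ.erase i).erase j))]
  · apply Finset.sum_congr rfl
    intro k hk
    simp only [Finset.mem_erase, Finset.mem_univ, and_true] at hk
    obtain ⟨hkj, hki⟩ := hk
    rcases lt_or_gt_of_ne hkj with h1 | h1 <;> rcases lt_or_gt_of_ne hki with h2 | h2
    · simp [h1, h2, h1.not_gt, h2.not_gt, hij]
    · simp [h1, h2, h1.not_gt, h2.not_gt, hij]
    · exact absurd (h1.trans h2) hij.not_gt
    · simp [h1, h2, h1.not_gt, h2.not_gt, hij]
  · intro k _ hk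
    have : k = j ∨ k = i := by
      by_contra hc
      apply hk
      simp only [Finset.mem_erase, Finset.mem_univ, and_true]
      tauto
    rcases this with rfl | rfl <;> simp [hij, hij.not_gt]

lemma tri_all' (q : Fin n → Fin n → Fin n → ℝ)
    (hq1 : ∀ i j k, q i j k = q j i k) (hq2 : ∀ i j k, q i j k = q i k j)
    (S : NetState n) (i j : Fin n) (hij : i ≠ j) :
    (∑ a, ∑ b, ∑ c,
        (if a < b ∧ b < c then q a b c * lnk (setLink S i j true) a b
          * lnk (setLink S i j true) b c * lnk (setLink S i j true) c a else 0))
      - ∑ a, ∑ b, ∑ c,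
        (if a < b ∧ b < c then q a b c * lnk (setLink S i j false) a b
          * lnk (setLink S i j false) b c * lnk (setLink S i j false) c a else 0)
      = ∑ k ∈ (Finset.univ.erase i).erase j, q i j k * lnk S i k * lnk S j k := by
  rcases lt_or_gt_of_ne hij with h1 | h1
  · exact tri_all q hq1 hq2 S i j h1
  · rw [setLink_comm S i j true, setLink_comm S i j false, tri_all q hq1 hq2 S j i h1,
      Finset.erase_right_comm]
    apply Finset.sum_congr rfl
    intro k _
    rw [hq1 j i k]; ring

/-- the incremental utility of agent `i` from the link with `j` equals the
incremental potential, and both equal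
`w_{ij} + φ (a_i a_j + (1−a_i)(1−a_j)) + Σ_{k ≠ i,j} q_{ijk} g_{ik} g_{jk}`. -/
theorem link_increment_eq_potential_increment {n : ℕ} (hn : 2 ≤ n)
    (v : Fin n → ℝ) (w : Fin n → Fin n → ℝ) (hw : ∀ i j, w i j = w j i)
    (q : Fin n → Fin n → Fin n → ℝ)
    (hq1 : ∀ i j k, q i j k = q j i k) (hq2 : ∀ i j k, q i j k = q i k j)
    (h φ : ℝ) (S : NetState n) (i j : Fin n) (hij : i ≠ j) :
    dLinkU v w q h φ i j S = dLinkP v w q h φ i j S ∧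
    dLinkU v w q h φ i j S =
      w i j + φ * (act S i * act S j + (1 - act S i) * (1 - act S j))
        + ∑ k ∈ (Finset.univ.erase i).erase j, q i j k * lnk S i k * lnk S j k := by
  have hU : dLinkU v w q h φ i j S =
      w i j + φ * (act S i * act S j + (1 - act S i) * (1 - act S j))
        + ∑ k ∈ (Finset.univ.erase i).erase j, q i j k * lnk S i k * lnk S j k := by
    unfold dLinkU util
    simp only [act_setLink]
    have e1 := lin_one S i j hij (fun k => w i k)
    have e2 := lin_one S i j hij
      (fun k => act S i * act S k + (1 - act S i) * (1 - act S k))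
    have e3 := tri_one q hq2 S i j hij
    linear_combination e1 + φ * e2 + e3
  have hP : dLinkP v w q h φ i j S =
      w i j + φ * (act S i * act S j + (1 - act S i) * (1 - act S j))
        + ∑ k ∈ (Finset.univ.erase i).erase j, q i j k * lnk S i k * lnk S j k := by
    unfold dLinkP potential
    simp only [act_setLink]
    have e1 := lin_all S i j hij w
    have e2 := lin_all S i j hij
      (fun p k => act S p * act S k + (1 - act S p) * (1 - act S k))
    have e3 := tri_all' q hq1 hq2 S i j hij
    have e4 := hw i j
    linear_combination (1 / 2) * e1 + (φ / 2) * e2 + e3 - (1 / 2) * e4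
  exact ⟨hU.trans hP.symm, hU⟩

end NEkSN
end

section
/- The difference between the potential and agent i's utility is constant on any k-neighborhood in which only i's coordinates vary: for every k-meeting μ = (i, I), every state S, and all S', S'' ∈ N_k(μ, S), one has u_i(S') − u_i(S'') = Φ(S') − Φ(S''). -/
open Finset

namespace NEkSN

variable {n : ℕ}

theorem pair_sum_aux_s3 {n : ℕ} (i : Fin n) (D : Fin n → Fin n → ℝ)
    (hs : ∀ x y, D x y = D y x) (h0 : ∀ x y, x ≠ i → y ≠ i → D x y = 0) :
    ∑ x, ∑ y ∈ univ.erase x, D x y = 2 * ∑ y ∈ univ.erase i, D i y := by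
  rw [← Finset.add_sum_erase univ _ (Finset.mem_univ i), two_mul]
  congr 1
  refine Finset.sum_congr rfl fun x hx => ?_
  have hxi : x ≠ i := Finset.ne_of_mem_erase hx
  rw [Finset.sum_eq_single i, hs]
  · intro y _ hy
    exact h0 x y hxi hy
  · intro hc
    exact absurd (Finset.mem_erase.2 ⟨hxi.symm, Finset.mem_univ i⟩) hc

theorem triple_sum_aux {n : ℕ} (i : Fin n) (D : Fin n → Fin n → Fin n → ℝ)
    (hs1 : ∀ x y z, D x y z = D y x z) (hs2 : ∀ x y z, D x y z = D x z y)
    (h0 : ∀ x y z, x ≠ i → y ≠ i → z ≠ i → D x y z = 0) :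
    ∑ x, ∑ y, ∑ z, (if x < y ∧ y < z then D x y z else 0) =
      ∑ y ∈ univ.erase i, ∑ z ∈ univ.erase i, (if y < z then D i y z else 0) := by
  have e1 : ∀ x y z, (if x < y ∧ y < z then D x y z else 0) =
      (if x = i then (if i < y ∧ y < z then D i y z else 0) else 0)
      + (if y = i then (if x < i ∧ i < z then D i x z else 0) else 0)
      + (if z = i then (if x < y ∧ y < i then D i x y else 0) else 0) := by
    intro x y z
    by_cases hx : x = i
    · subst hx
      by_cases hy : y = x <;> by_cases hz : z = x <;> grind
    · by_cases hy : y = i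
      · subst hy
        have := hs1 x y z
        by_cases hz : z = y <;> grind
      · by_cases hz : z = i
        · subst hz
          have : D x y z = D z x y := by rw [hs2, hs1]
          grind
        · simp [hx, hy, hz, h0 x y z hx hy hz]
  have e2 : ∀ f : Fin n → ℝ, ∑ y ∈ univ.erase i, f y = ∑ y, if y ≠ i then f y else 0 := by
    intro f
    rw [← Finset.sum_filter]
    congr 1
    ext; simp
  have c1 : ∑ x, ∑ y, ∑ z, (if x = i then (if i < y ∧ y < z then D i y z else 0) else 0)
      = ∑ y, ∑ z, (if i < y ∧ y < z then D i y z else 0) := by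
    rw [Finset.sum_eq_single i]
    · simp
    · intro b _ hb; simp [hb]
    · simp
  have c2 : ∑ x, ∑ y, ∑ z, (if y = i then (if x < i ∧ i < z then D i x z else 0) else 0)
      = ∑ y, ∑ z, (if y < i ∧ i < z then D i y z else 0) := by
    refine Finset.sum_congr rfl fun x _ => ?_
    rw [Finset.sum_eq_single i]
    · simp
    · intro b _ hb; simp [hb]
    · simp
  have c3 : ∑ x, ∑ y, ∑ z, (if z = i then (if x < y ∧ y < i then D i x y else 0) else 0)
      = ∑ y, ∑ z, (if y < z ∧ z < i then D i y z else 0) := by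
    simp
  rw [Finset.sum_congr rfl fun x _ => Finset.sum_congr rfl fun y _ =>
    Finset.sum_congr rfl fun z _ => e1 x y z]
  simp only [Finset.sum_add_distrib]
  rw [c1, c2, c3, e2]
  simp only [← Finset.sum_add_distrib]
  refine Finset.sum_congr rfl fun y _ => ?_
  rw [e2]
  by_cases hy : y = i
  · subst hy
    rw [if_neg (by simp)]
    refine Finset.sum_eq_zero fun z _ => ?_
    grind
  · rw [if_pos hy]
    refine Finset.sum_congr rfl fun z _ => ?_
    grind

theorem lnk_comm_aux {n : ℕ} (S : NetState n) (x y : Fin n) : lnk S x y = lnk S y x := by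
  simp only [lnk, S.2.1 x y]

/-- on any `k`-neighborhood where only `i`'s coordinates vary, the
difference between `i`'s utility and the potential is constant. -/
theorem util_diff_eq_potential_diff_on_nbhd {n : ℕ} (hn : 2 ≤ n)
    (v : Fin n → ℝ) (w : Fin n → Fin n → ℝ) (hw : ∀ i j, w i j = w j i)
    (q : Fin n → Fin n → Fin n → ℝ)
    (hq1 : ∀ i j k, q i j k = q j i k) (hq2 : ∀ i j k, q i j k = q i k j)
    (h φ : ℝ) (k : ℕ) (hk1 : 1 < k) (hk2 : k ≤ n) (μ : Meeting n k)
    (S S' S'' : NetState n) (h' : S' ∈ nbhd μ S) (h'' : S'' ∈ nbhd μ S) :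
    util v w q h φ μ.1.1 S' - util v w q h φ μ.1.1 S'' =
      potential v w q h φ S' - potential v w q h φ S'' := by
  obtain ⟨⟨i, I⟩, hμ⟩ := μ
  simp only [nbhd, Finset.mem_filter, Finset.mem_univ, true_and] at h' h''
  have ha : ∀ x, x ≠ i → act S' x = act S'' x := by
    intro x hx
    simp only [act, h'.1 x hx, h''.1 x hx]
  have hl : ∀ x y, x ≠ i → y ≠ i → lnk S' x y = lnk S'' x y := by
    intro x y hx hy
    simp only [lnk, h'.2 x y (by tauto), h''.2 x y (by tauto)]
  have t1 : ∑ x, (act S' x * v x - act S'' x * v x) = act S' i * v i - act S'' i * v i := by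
    rw [Finset.sum_eq_single i]
    · intro x _ hx
      rw [ha x hx, sub_self]
    · simp
  have t2 := pair_sum_aux_s3 i (fun x y => lnk S' x y * w x y - lnk S'' x y * w x y)
    (fun x y => by simp only [lnk_comm_aux _ x y, hw x y])
    (fun x y hx hy => by simp only [hl x y hx hy, sub_self])
  have t3 := pair_sum_aux_s3 i (fun x y => act S' x * act S' y - act S'' x * act S'' y)
    (fun x y => by ring)
    (fun x y hx hy => by simp only [ha x hx, ha y hy, sub_self])
  have t4 := pair_sum_aux_s3 i
    (fun x y => lnk S' x y * (act S' x * act S' y + (1 - act S' x) * (1 - act S' y))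
      - lnk S'' x y * (act S'' x * act S'' y + (1 - act S'' x) * (1 - act S'' y)))
    (fun x y => by simp only [lnk_comm_aux _ x y]; ring)
    (fun x y hx hy => by simp only [hl x y hx hy, ha x hx, ha y hy, sub_self])
  have t5 := triple_sum_aux i
    (fun x y z => q x y z * lnk S' x y * lnk S' y z * lnk S' z x
      - q x y z * lnk S'' x y * lnk S'' y z * lnk S'' z x)
    (fun x y z => by
      simp only [hq1 x y z, lnk_comm_aux _ x y, lnk_comm_aux _ y z, lnk_comm_aux _ z x]; ring)
    (fun x y z => by
      simp only [hq2 x y z, lnk_comm_aux _ x y, lnk_comm_aux _ y z, lnk_comm_aux _ z x]; ring)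
    (fun x y z hx hy hz => by simp only [hl x y hx hy, hl y z hy hz, hl z x hz hx, sub_self])
  have ite_sub_aux : ∀ (p : Prop) [Decidable p] (a b : ℝ),
      (if p then a - b else 0) = (if p then a else 0) - (if p then b else 0) := by
    intro p _ a b
    split_ifs <;> simp
  simp only [ite_sub_aux, Finset.sum_sub_distrib] at t1 t2 t3 t4 t5
  simp only [← Finset.mul_sum] at t3
  simp only [util, potential, ← Finset.mul_sum]
  linear_combination (-1) * t1 - (1 / 2) * t2 - (h / 2) * t3 - (φ / 2) * t4 - t5

end NEkSN
end

section
/- The individual decision problem is well defined and has a solution (Proposition 1, part 1): for every state S, every 1 < k ≤ n, and every k-meeting μ = (i, I), the problem of maximizing u_i(S') over S' ∈ N_k(μ, S) subject to the stability constraints (for each j ∈ I, g'_{ij} = 1 only if Δ_{g_{ij}} u_j(S') ≥ 0) has a nonempty solution set, and this solution set equals the set of maximizers of Φ over N_k(μ, S). -/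
open Finset

namespace NEkSN

variable {n : ℕ}

theorem pair_split (F : Fin n → Fin n → ℝ) (hF : ∀ a b, F a b = F b a) (i : Fin n) :
    ∑ p, ∑ r ∈ univ.erase p, F p r
      = 2 * ∑ r ∈ univ.erase i, F i r
        + ∑ p ∈ univ.erase i, ∑ r ∈ (univ.erase p).erase i, F p r := by
  rw [← Finset.add_sum_erase univ _ (mem_univ i)]
  have : ∀ p ∈ univ.erase i, ∑ r ∈ univ.erase p, F p r
      = F i p + ∑ r ∈ (univ.erase p).erase i, F p r := by
    intro p hp
    have hpi : p ≠ i := (Finset.mem_erase.1 hp).1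
    rw [← Finset.add_sum_erase (univ.erase p) _ (Finset.mem_erase.2 ⟨hpi.symm, mem_univ i⟩),
      hF p i]
  rw [Finset.sum_congr rfl this, Finset.sum_add_distrib]
  ring

theorem triple_split (G : Fin n → Fin n → Fin n → ℝ)
    (h1 : ∀ a b c, G a b c = G b a c) (h2 : ∀ a b c, G a b c = G a c b) (i : Fin n) :
    ∑ p, ∑ r, ∑ s, (if p < r ∧ r < s then G p r s else 0)
      = ∑ r ∈ univ.erase i, ∑ s ∈ univ.erase i, (if r < s then G i r s else 0)
        + ∑ p ∈ univ.erase i, ∑ r ∈ univ.erase i, ∑ s ∈ univ.erase i,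
            (if p < r ∧ r < s then G p r s else 0) := by
  have hs : ∀ f : Fin n → ℝ, ∑ x, f x = f i + ∑ x ∈ univ.erase i, f x :=
    fun f => (Finset.add_sum_erase univ f (mem_univ i)).symm
  simp only [hs, Finset.sum_add_distrib]
  simp only [lt_irrefl, false_and, and_false, if_false, Finset.sum_const_zero, zero_add, add_zero]
  have e1 : ∑ r ∈ univ.erase i, (if i < r ∧ r < i then G i r i else 0) = 0 := by
    apply Finset.sum_eq_zero
    intro r _
    rw [if_neg]
    rintro ⟨a, b⟩
    exact lt_asymm a b
  rw [e1, zero_add, ← add_assoc, ← add_assoc]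
  congr 1
  rw [← Finset.sum_add_distrib, ← Finset.sum_add_distrib]
  refine Finset.sum_congr rfl fun r hr => ?_
  rw [← Finset.sum_add_distrib, ← Finset.sum_add_distrib]
  refine Finset.sum_congr rfl fun s hs' => ?_
  have hri : r ≠ i := (Finset.mem_erase.1 hr).1
  have hsi : s ≠ i := (Finset.mem_erase.1 hs').1
  have g1 : G r i s = G i r s := h1 _ _ _
  have g2 : G r s i = G i r s := by rw [h2, h1]
  rw [g1, g2]
  rcases lt_or_gt_of_ne hri with a | a <;> rcases lt_or_gt_of_ne hsi with b | b <;>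
    by_cases c : r < s <;> simp [a, b, c, a.not_gt, b.not_gt] <;> order

/-- Potential minus `i`'s utility depends only on coordinates not involving `i`. -/
theorem pot_sub_util (v : Fin n → ℝ) (w : Fin n → Fin n → ℝ) (hw : ∀ i j, w i j = w j i)
    (q : Fin n → Fin n → Fin n → ℝ)
    (hq1 : ∀ i j k, q i j k = q j i k) (hq2 : ∀ i j k, q i j k = q i k j)
    (h φ : ℝ) (i : Fin n) (S : NetState n) :
    potential v w q h φ S = util v w q h φ i S
      + ((∑ p ∈ univ.erase i, act S p * v p)
        + (1 / 2) * ∑ p ∈ univ.erase i, ∑ r ∈ (univ.erase p).erase i, lnk S p r * w p r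
        + (h / 2) * ∑ p ∈ univ.erase i, ∑ r ∈ (univ.erase p).erase i, act S p * act S r
        + (φ / 2) * ∑ p ∈ univ.erase i, ∑ r ∈ (univ.erase p).erase i,
            lnk S p r * (act S p * act S r + (1 - act S p) * (1 - act S r))
        + ∑ p ∈ univ.erase i, ∑ r ∈ univ.erase i, ∑ s ∈ univ.erase i,
            (if p < r ∧ r < s then q p r s * lnk S p r * lnk S r s * lnk S s p else 0)) := by
  have hl : ∀ a b, lnk S a b = lnk S b a := fun a b => by unfold lnk; rw [S.2.1 a b]
  unfold potential util
  rw [← Finset.add_sum_erase univ (fun p => act S p * v p) (mem_univ i),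
    pair_split (fun a b => lnk S a b * w a b) (fun a b => by rw [hl a b, hw a b]) i,
    pair_split (fun a b => act S a * act S b) (fun a b => mul_comm _ _) i,
    pair_split (fun a b => lnk S a b * (act S a * act S b + (1 - act S a) * (1 - act S b)))
      (fun a b => by rw [hl a b]; ring) i,
    triple_split (fun a b c => q a b c * lnk S a b * lnk S b c * lnk S c a)
      (fun a b c => by rw [hq1 a b c, hl a b, hl b c, hl c a]; ring)
      (fun a b c => by rw [hq2 a b c, hl a b, hl b c, hl c a]; ring) i]
  simp only [← Finset.mul_sum]
  ring

theorem pot_diff (v : Fin n → ℝ) (w : Fin n → Fin n → ℝ) (hw : ∀ i j, w i j = w j i)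
    (q : Fin n → Fin n → Fin n → ℝ)
    (hq1 : ∀ i j k, q i j k = q j i k) (hq2 : ∀ i j k, q i j k = q i k j)
    (h φ : ℝ) (i : Fin n) (S T : NetState n)
    (ha : ∀ p, p ≠ i → S.1.1 p = T.1.1 p)
    (hg : ∀ p r, p ≠ i → r ≠ i → S.1.2 p r = T.1.2 p r) :
    potential v w q h φ S - potential v w q h φ T
      = util v w q h φ i S - util v w q h φ i T := by
  have ha' : ∀ p, p ≠ i → act S p = act T p := fun p hp => by unfold act; rw [ha p hp]
  have hg' : ∀ p r, p ≠ i → r ≠ i → lnk S p r = lnk T p r :=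
    fun p r hp hr => by unfold lnk; rw [hg p r hp hr]
  rw [pot_sub_util v w hw q hq1 hq2 h φ i S, pot_sub_util v w hw q hq1 hq2 h φ i T]
  rw [add_sub_add_comm, add_eq_left, sub_eq_zero]
  congr 1
  · congr 1
    · congr 1
      · congr 1
        · exact Finset.sum_congr rfl fun p hp => by rw [ha' p (Finset.mem_erase.1 hp).1]
        · congr 1
          exact Finset.sum_congr rfl fun p hp => Finset.sum_congr rfl fun r hr => by
            rw [hg' p r (Finset.mem_erase.1 hp).1 (Finset.mem_erase.1 hr).1]
      · congr 1
        exact Finset.sum_congr rfl fun p hp => Finset.sum_congr rfl fun r hr => by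
          rw [ha' p (Finset.mem_erase.1 hp).1, ha' r (Finset.mem_erase.1 hr).1]
    · congr 1
      exact Finset.sum_congr rfl fun p hp => Finset.sum_congr rfl fun r hr => by
        rw [hg' p r (Finset.mem_erase.1 hp).1 (Finset.mem_erase.1 hr).1,
          ha' p (Finset.mem_erase.1 hp).1, ha' r (Finset.mem_erase.1 hr).1]
  · exact Finset.sum_congr rfl fun p hp => Finset.sum_congr rfl fun r hr =>
      Finset.sum_congr rfl fun s hs => by
        rw [hg' p r (Finset.mem_erase.1 hp).1 (Finset.mem_erase.1 hr).1,
          hg' r s (Finset.mem_erase.1 hr).1 (Finset.mem_erase.1 hs).1,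
          hg' s p (Finset.mem_erase.1 hs).1 (Finset.mem_erase.1 hp).1]

/-- Proposition 1, part 1: the individual decision problem on a
`k`-neighborhood, subject to the stability constraints, has a nonempty solution set which
equals the set of maximizers of the potential over the neighborhood. -/
theorem decision_problem_solvable {n : ℕ} (hn : 2 ≤ n)
    (v : Fin n → ℝ) (w : Fin n → Fin n → ℝ) (hw : ∀ i j, w i j = w j i)
    (q : Fin n → Fin n → Fin n → ℝ)
    (hq1 : ∀ i j k, q i j k = q j i k) (hq2 : ∀ i j k, q i j k = q i k j)
    (h φ : ℝ) (k : ℕ) (hk1 : 1 < k) (hk2 : k ≤ n) (μ : Meeting n k) (S : NetState n) :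
    (∃ S' ∈ feasible v w q h φ μ S,
        ∀ T ∈ feasible v w q h φ μ S,
          util v w q h φ μ.1.1 T ≤ util v w q h φ μ.1.1 S') ∧
    {S' | S' ∈ feasible v w q h φ μ S ∧
        ∀ T ∈ feasible v w q h φ μ S,
          util v w q h φ μ.1.1 T ≤ util v w q h φ μ.1.1 S'} =
      {S' | S' ∈ nbhd μ S ∧
        ∀ T ∈ nbhd μ S, potential v w q h φ T ≤ potential v w q h φ S'} := by
  have hsub : ∀ T ∈ feasible v w q h φ μ S, T ∈ nbhd μ S := fun T hT => hT.1
  have hmem : ∀ T, T ∈ nbhd μ S ↔ (∀ p, p ≠ μ.1.1 → T.1.1 p = S.1.1 p) ∧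
      (∀ p q, ¬((p = μ.1.1 ∧ q ∈ μ.1.2) ∨ (q = μ.1.1 ∧ p ∈ μ.1.2)) →
        T.1.2 p q = S.1.2 p q) := fun T => by simp [nbhd]
  have hdiff : ∀ T ∈ nbhd μ S, ∀ T' ∈ nbhd μ S,
      potential v w q h φ T - potential v w q h φ T'
        = util v w q h φ μ.1.1 T - util v w q h φ μ.1.1 T' := by
    intro T hT T' hT'
    rw [hmem] at hT hT'
    refine pot_diff v w hw q hq1 hq2 h φ μ.1.1 T T' (fun p hp => ?_) (fun p r hp hr => ?_)
    · rw [hT.1 p hp, hT'.1 p hp]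
    · rw [hT.2 p r (by tauto), hT'.2 p r (by tauto)]
  have hfeas : ∀ T, T ∈ nbhd μ S →
      (∀ T' ∈ nbhd μ S, potential v w q h φ T' ≤ potential v w q h φ T) →
      T ∈ feasible v w q h φ μ S := by
    intro T hT hmax
    refine ⟨hT, fun j hj hlink => ?_⟩
    have hji : j ≠ μ.1.1 := fun e => μ.2.1 (e ▸ hj)
    have htrue : setLink T j μ.1.1 true = T := by
      apply Subtype.ext
      refine Prod.ext rfl ?_
      funext p r
      simp only [setLink]
      split_ifs with h1 h2
      · rw [h1, T.2.2]
      · rcases h2 with ⟨rfl, rfl⟩ | ⟨rfl, rfl⟩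
        · rw [T.2.1, hlink]
        · rw [hlink]
      · rfl
    have hfalse : setLink T j μ.1.1 false ∈ nbhd μ S := by
      rw [hmem] at hT ⊢
      refine ⟨hT.1, fun p r hpr => ?_⟩
      rw [← hT.2 p r hpr]
      simp only [setLink]
      split_ifs with h1 h2
      · rw [h1, T.2.2]
      · exfalso
        rcases h2 with ⟨rfl, h2⟩ | ⟨h2, rfl⟩ <;> tauto
      · rfl
    unfold dLinkU
    rw [← pot_diff v w hw q hq1 hq2 h φ j (setLink T j μ.1.1 true) (setLink T j μ.1.1 false)
      (fun p hp => rfl) (fun p r hp hr => by simp [setLink, hp, hr]), htrue]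
    exact sub_nonneg.2 (hmax _ hfalse)
  obtain ⟨M, hM, hMmax⟩ := Finset.exists_max_image (nbhd μ S) (potential v w q h φ)
    ⟨S, (hmem S).2 ⟨fun _ _ => rfl, fun _ _ _ => rfl⟩⟩
  have hMf := hfeas M hM hMmax
  refine ⟨⟨M, hMf, fun T hT => ?_⟩, ?_⟩
  · have := hdiff T hT.1 M hM
    have := hMmax T hT.1
    linarith
  · ext T
    constructor
    · rintro ⟨hT, hTmax⟩
      refine ⟨hT.1, fun T' hT' => ?_⟩
      have := hTmax M hMf
      have := hdiff T hT.1 M hM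
      have := hMmax T' hT'
      linarith
    · rintro ⟨hT, hTmax⟩
      refine ⟨hfeas T hT hTmax, fun T' hT' => ?_⟩
      have := hdiff T' hT'.1 T hT
      have := hTmax T' hT'.1
      linarith

end NEkSN
end

section
/- Pairwise stability (Proposition 2, part 1): every Nash equilibrium S in a 2-stable network (NE2SN) is pairwise stable: (a) for all i ≠ j with g_{ij} = 1, both Δ_{g_{ij}} u_i(S) ≥ 0 and Δ_{g_{ij}} u_j(S) ≥ 0; and (b) for all i ≠ j with g_{ij} = 0, it is not the case that Δ_{g_{ij}} u_i(S) > 0 and Δ_{g_{ij}} u_j(S) ≥ 0. -/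
open Finset

namespace NEkSN

variable {n : ℕ}

/-- Setting the same link twice: the last value wins. -/
lemma setLink_setLink {n : ℕ} (S : NetState n) (i j : Fin n) (b c : Bool) :
    setLink (setLink S i j b) j i c = setLink S j i c := by
  apply Subtype.ext
  refine Prod.ext rfl ?_
  funext p r
  simp only [setLink]
  by_cases hpr : p = r
  · simp [hpr]
  · by_cases hc : (p = j ∧ r = i) ∨ (p = i ∧ r = j)
    · simp [hpr, hc]
    · rw [if_neg hpr, if_neg hpr, if_neg hc, if_neg hc, if_neg hpr, if_neg (by tauto)]

/-- Setting a link to its current value changes nothing. -/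
lemma setLink_self {n : ℕ} (S : NetState n) (i j : Fin n) (b : Bool)
    (hb : S.1.2 i j = b) : setLink S i j b = S := by
  apply Subtype.ext
  refine Prod.ext rfl ?_
  funext p r
  simp only [setLink]
  by_cases hpr : p = r
  · subst hpr
    simp [S.2.2 p]
  · rw [if_neg hpr]
    split
    · rename_i hc
      rcases hc with ⟨rfl, rfl⟩ | ⟨rfl, rfl⟩
      · exact hb.symm
      · rw [S.2.1]; exact hb.symm
    · rfl

/-- Proposition 2, part 1: every NE2SN is pairwise stable. -/
theorem ne2sn_pairwise_stable {n : ℕ} (hn : 2 ≤ n)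
    (v : Fin n → ℝ) (w : Fin n → Fin n → ℝ) (hw : ∀ i j, w i j = w j i)
    (q : Fin n → Fin n → Fin n → ℝ)
    (hq1 : ∀ i j k, q i j k = q j i k) (hq2 : ∀ i j k, q i j k = q i k j)
    (h φ : ℝ) (S : NetState n) (hS : isNEkSN v w q h φ 2 S) :
    (∀ i j : Fin n, i ≠ j → S.1.2 i j = true →
        0 ≤ dLinkU v w q h φ i j S ∧ 0 ≤ dLinkU v w q h φ j i S) ∧
    (∀ i j : Fin n, i ≠ j → S.1.2 i j = false →
        ¬(0 < dLinkU v w q h φ i j S ∧ 0 ≤ dLinkU v w q h φ j i S)) := by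
  have key : ∀ i j : Fin n, i ≠ j → S.1.2 i j = true → 0 ≤ dLinkU v w q h φ j i S := by
    intro i j hij hg
    exact (hS ⟨(i, {j}), by simpa using hij, by simp⟩).1.2 j (by simp) hg
  refine ⟨fun i j hij hg => ⟨key j i hij.symm (by rw [S.2.1]; exact hg), key i j hij hg⟩, ?_⟩
  rintro i j hij hg ⟨h1, h2⟩
  have hle := (hS ⟨(i, {j}), by simpa using hij, by simp⟩).2 (setLink S i j true) (by
    refine ⟨?_, ?_⟩
    · simp only [nbhd, Finset.mem_filter, Finset.mem_univ, true_and, Finset.mem_singleton]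
      refine ⟨fun p _ => rfl, fun p r hc => ?_⟩
      simp only [setLink]
      by_cases hpr : p = r
      · subst hpr
        simp [S.2.2 p]
      · rw [if_neg hpr, if_neg (by tauto)]
    · intro k hk _
      have hkj : k = j := by simpa using hk
      subst hkj
      unfold dLinkU at h2 ⊢
      simpa only [setLink_setLink] using h2)
  unfold dLinkU at h1
  rw [setLink_self S i j false hg] at h1
  exact absurd hle (not_le.mpr (by linarith))

end NEkSN
end

section
/- Detailed balance and k-independent stationarity (Theorem 1, part 2): for every 1 < k ≤ n and all network states S, S', the kCD transition kernel satisfies exp(Φ(S)) · P_k(S' | S) = exp(Φ(S')) · P_k(S | S'). Consequently, the Gibbs distribution π(S) = exp(Φ(S)) / Σ_{Ŝ ∈ 𝒮ₙ} exp(Φ(Ŝ)) is a stationary distribution of P_k for every such k: Σ_{S ∈ 𝒮ₙ} π(S) P_k(S' | S) = π(S') for all S'; in particular the stationary distribution does not depend on k. -/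
open Finset

namespace NEkSN

variable {n : ℕ}

theorem self_mem_nbhd {n k : ℕ} (μ : Meeting n k) (S : NetState n) : S ∈ nbhd μ S := by
  simp [nbhd]

theorem nbhd_symm {n k : ℕ} {μ : Meeting n k} {S S' : NetState n} (hS : S' ∈ nbhd μ S) :
    S ∈ nbhd μ S' := by
  simp only [nbhd, mem_filter, mem_univ, true_and] at hS ⊢
  exact ⟨fun p hp => (hS.1 p hp).symm, fun p r hp => (hS.2 p r hp).symm⟩

theorem nbhd_trans {n k : ℕ} {μ : Meeting n k} {S S' T : NetState n} (hS : S' ∈ nbhd μ S)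
    (hT : T ∈ nbhd μ S') : T ∈ nbhd μ S := by
  simp only [nbhd, mem_filter, mem_univ, true_and] at hS hT ⊢
  exact ⟨fun p hp => (hT.1 p hp).trans (hS.1 p hp),
    fun p r hp => (hT.2 p r hp).trans (hS.2 p r hp)⟩

theorem nbhd_eq {n k : ℕ} {μ : Meeting n k} {S S' : NetState n} (hS : S' ∈ nbhd μ S) :
    nbhd μ S' = nbhd μ S :=
  Finset.ext fun _ => ⟨fun hT => nbhd_trans hS hT, fun hT => nbhd_trans (nbhd_symm hS) hT⟩

theorem kernel_balance {n : ℕ} (v : Fin n → ℝ) (w : Fin n → Fin n → ℝ)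
    (q : Fin n → Fin n → Fin n → ℝ) (h φ : ℝ) (k : ℕ) (ρ : Meeting n k → ℝ)
    (S S' : NetState n) :
    Real.exp (potential v w q h φ S) * kernel v w q h φ k ρ S' S =
      Real.exp (potential v w q h φ S') * kernel v w q h φ k ρ S S' := by
  unfold kernel
  rw [Finset.mul_sum, Finset.mul_sum]
  refine Finset.sum_congr rfl fun μ _ => ?_
  by_cases hS : S' ∈ nbhd μ S
  · rw [if_pos hS, if_pos (nbhd_symm hS), nbhd_eq hS]
    ring
  · rw [if_neg hS, if_neg (fun hc => hS (nbhd_symm hc))]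
    simp

theorem kernel_sum {n : ℕ} (v : Fin n → ℝ) (w : Fin n → Fin n → ℝ)
    (q : Fin n → Fin n → Fin n → ℝ) (h φ : ℝ) (k : ℕ) (ρ : Meeting n k → ℝ)
    (hρsum : ∑ μ : Meeting n k, ρ μ = 1) (S : NetState n) :
    ∑ S' : NetState n, kernel v w q h φ k ρ S' S = 1 := by
  unfold kernel
  rw [Finset.sum_comm, ← hρsum]
  refine Finset.sum_congr rfl fun μ _ => ?_
  have hpos : 0 < ∑ T ∈ nbhd μ S, Real.exp (potential v w q h φ T) :=
    Finset.sum_pos (fun _ _ => Real.exp_pos _) ⟨S, self_mem_nbhd μ S⟩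
  rw [← Finset.sum_filter, Finset.filter_mem_eq_inter, Finset.univ_inter, ← Finset.sum_div,
    ← Finset.mul_sum, mul_div_assoc, div_self hpos.ne', mul_one]

/-- Theorem 1, part 2: detailed balance
`exp(Φ(S)) P_k(S'|S) = exp(Φ(S')) P_k(S|S')`, and hence the Gibbs distribution
(which does not depend on `k`) is stationary for every `k`. -/
theorem detailed_balance_and_stationarity {n : ℕ} (hn : 2 ≤ n)
    (v : Fin n → ℝ) (w : Fin n → Fin n → ℝ) (hw : ∀ i j, w i j = w j i)
    (q : Fin n → Fin n → Fin n → ℝ)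
    (hq1 : ∀ i j k, q i j k = q j i k) (hq2 : ∀ i j k, q i j k = q i k j)
    (h φ : ℝ) (k : ℕ) (hk1 : 1 < k) (hk2 : k ≤ n)
    (ρ : Meeting n k → ℝ) (hρpos : ∀ μ, 0 < ρ μ) (hρsum : ∑ μ : Meeting n k, ρ μ = 1) :
    (∀ S S' : NetState n,
      Real.exp (potential v w q h φ S) * kernel v w q h φ k ρ S' S =
        Real.exp (potential v w q h φ S') * kernel v w q h φ k ρ S S') ∧
    (∀ S' : NetState n,
      ∑ S : NetState n, gibbs v w q h φ S * kernel v w q h φ k ρ S' S =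
        gibbs v w q h φ S') := by
  refine ⟨kernel_balance v w q h φ k ρ, fun S' => ?_⟩
  have key : ∀ S : NetState n, gibbs v w q h φ S * kernel v w q h φ k ρ S' S =
      gibbs v w q h φ S' * kernel v w q h φ k ρ S S' := fun S => by
    unfold gibbs
    rw [div_mul_eq_mul_div, div_mul_eq_mul_div, kernel_balance]
  rw [Finset.sum_congr rfl fun S _ => key S, ← Finset.mul_sum, kernel_sum v w q h φ k ρ hρsum,
    mul_one]

end NEkSN
end
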